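/- arXiv:2404.11173 — 2 statements merged into one kernel-verified Lean document; each statement's English description precedes it below -/
import Mathlib

section
/- For natural numbers n and m with n > m, the integral ∫₀¹ Pₙ(2x−1)·Pₘ(2x−1)·log(x) dx equals (−1)^(n+m+1) / ((n−m)(n+m+1)). -/
open MeasureTheory Real

/-- The Legendre polynomials, defined by `P 0 x = 1`, `P 1 x = x` and the
three-term recurrence `(n+1) * P (n+1) x = (2*n+1) * x * P n x - n * P (n-1) x` for `n ≥ 1`. -/
noncomputable def legendreP : ℕ → ℝ → ℝ
  | 0, _ => 1
  | 1, x => x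
  | (n + 2), x =>
      ((2 * (n + 1 : ℝ) + 1) * x * legendreP (n + 1) x - (n + 1 : ℝ) * legendreP n x)
        / ((n + 1 : ℝ) + 1)

/-- `N n m = ∫₀¹ Pₙ(2x-1) Pₘ(2x-1) log x dx`. -/
noncomputable def N (n m : ℕ) : ℝ :=
  ∫ x in (0:ℝ)..1, legendreP n (2 * x - 1) * legendreP m (2 * x - 1) * Real.log x

open Polynomial in
/-- The Legendre polynomials shifted to `[0, 1]`, as polynomials: `x ↦ Pₙ(2x - 1)`. -/
noncomputable def shiftedLegendreP : ℕ → ℝ[X]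
  | 0 => 1
  | 1 => 2 * X - 1
  | (n + 2) => C (1 / ((n : ℝ) + 2)) *
      ((2 * (n : ℝ[X]) + 3) * (2 * X - 1) * shiftedLegendreP (n + 1)
        - ((n : ℝ[X]) + 1) * shiftedLegendreP n)

namespace shiftedLegendreP

open Polynomial

theorem recurrence (n : ℕ) :
    ((n : ℝ[X]) + 2) * shiftedLegendreP (n + 2) =
      (2 * (n : ℝ[X]) + 3) * (2 * X - 1) * shiftedLegendreP (n + 1)
        - ((n : ℝ[X]) + 1) * shiftedLegendreP n := by
  have hn : ((n : ℝ[X]) + 2) * C (1 / ((n : ℝ) + 2)) = 1 := by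
    have h0 : (n : ℝ) + 2 ≠ 0 := by positivity
    have hc : ((n : ℝ[X]) + 2) = C ((n : ℝ) + 2) := by
      rw [C_add, map_natCast, map_ofNat]
    rw [hc, ← C_mul, mul_one_div_cancel h0, C_1]
  rw [shiftedLegendreP, ← mul_assoc, hn, one_mul]

theorem eval_eq_legendreP (n : ℕ) (x : ℝ) :
    (shiftedLegendreP n).eval x = legendreP n (2 * x - 1) := by
  induction n using Nat.twoStepInduction with
  | zero => simp [shiftedLegendreP, legendreP]
  | one => simp [shiftedLegendreP, legendreP]
  | more n ih0 ih1 =>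
    have h0 : (n : ℝ) + 2 ≠ 0 := by positivity
    have h := congrArg (eval x) (recurrence n)
    simp only [eval_mul, eval_add, eval_sub, eval_natCast, eval_ofNat, eval_one, eval_X,
      ih0, ih1] at h
    have h1 : (n : ℝ) + 1 + 1 = n + 2 := by ring
    rw [legendreP, h1, eq_div_iff h0]
    linear_combination h

theorem eval_zero (n : ℕ) : (shiftedLegendreP n).eval 0 = (-1) ^ n := by
  induction n using Nat.twoStepInduction with
  | zero => simp [shiftedLegendreP]
  | one => simp [shiftedLegendreP]
  | more n ih0 ih1 =>
    have h0 : (n : ℝ) + 2 ≠ 0 := by positivity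
    have h := congrArg (eval 0) (recurrence n)
    simp only [eval_mul, eval_add, eval_sub, eval_natCast, eval_ofNat, eval_one, eval_X,
      ih0, ih1] at h
    apply mul_left_cancel₀ h0
    rw [h]
    ring

theorem natDegree_le (n : ℕ) : (shiftedLegendreP n).natDegree ≤ n := by
  induction n using Nat.twoStepInduction with
  | zero => simp [shiftedLegendreP]
  | one => rw [shiftedLegendreP]; compute_degree
  | more n ih0 ih1 =>
    rw [shiftedLegendreP]
    refine (natDegree_C_mul_le _ _).trans ((natDegree_sub_le _ _).trans (max_le ?_ ?_))
    · have h : ((2 * (n : ℝ[X]) + 3) * (2 * X - 1)).natDegree ≤ 1 := by compute_degree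
      exact (natDegree_mul_le_of_le h ih1).trans (by omega)
    · have h : ((n : ℝ[X]) + 1).natDegree ≤ 0 := by compute_degree
      exact (natDegree_mul_le_of_le h ih0).trans (by omega)

theorem derivative_succ_and_sub (n : ℕ) :
    derivative (shiftedLegendreP (n + 1)) =
        (2 * X - 1) * derivative (shiftedLegendreP n) + 2 * ((n : ℝ[X]) + 1) * shiftedLegendreP n ∧
      (2 * X - 1) * derivative (shiftedLegendreP (n + 1)) - derivative (shiftedLegendreP n) =
        2 * ((n : ℝ[X]) + 1) * shiftedLegendreP (n + 1) := by
  induction n with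
  | zero =>
    constructor
    · simp [shiftedLegendreP]
    · simp [shiftedLegendreP]
      ring
  | succ n ih =>
    obtain ⟨hA, hB⟩ := ih
    have h0 : (n : ℝ[X]) + 2 ≠ 0 := by exact_mod_cast (by omega : n + 2 ≠ 0)
    have hr := recurrence n
    have hd := congrArg derivative hr
    simp only [derivative_mul, derivative_sub, derivative_add, derivative_natCast, derivative_ofNat,
      derivative_one, derivative_X] at hd
    have hA' : derivative (shiftedLegendreP (n + 2)) =
        (2 * X - 1) * derivative (shiftedLegendreP (n + 1)) +
          2 * ((n : ℝ[X]) + 2) * shiftedLegendreP (n + 1) := by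
      apply mul_left_cancel₀ h0
      linear_combination hd + ((n : ℝ[X]) + 1) * hB
    push_cast
    constructor
    · linear_combination hA'
    · show (2 * X - 1) * derivative (shiftedLegendreP (n + 2)) - _ = _ * shiftedLegendreP (n + 2)
      linear_combination (2 * X - 1) * hA' - 2 * hr + (2 * X - 1) * hB - hA

/-- The Legendre differential equation on `[0, 1]`. -/
theorem derivative_mul_derivative (n : ℕ) :
    derivative (X * (1 - X) * derivative (shiftedLegendreP n)) =
      -((n : ℝ[X]) * ((n : ℝ[X]) + 1)) * shiftedLegendreP n := by
  cases n with
  | zero => simp [shiftedLegendreP]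
  | succ n =>
    obtain ⟨hA, hB⟩ := derivative_succ_and_sub n
    have h2 : (2 : ℝ[X]) ≠ 0 := two_ne_zero
    have hC : 2 * (X * (1 - X) * derivative (shiftedLegendreP (n + 1))) =
        ((n : ℝ[X]) + 1) * (shiftedLegendreP n - (2 * X - 1) * shiftedLegendreP (n + 1)) := by
      apply mul_left_cancel₀ h2
      linear_combination hA - (2 * X - 1) * hB
    apply mul_left_cancel₀ h2
    have hd := congrArg derivative hC
    rw [derivative_mul, derivative_ofNat, zero_mul, zero_add] at hd
    rw [hd]
    simp only [derivative_mul, derivative_sub, derivative_add, derivative_natCast, derivative_ofNat,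
      derivative_one, derivative_X]
    push_cast
    linear_combination (-(n : ℝ[X]) - 1) * hB

end shiftedLegendreP

namespace Polynomial

theorem intervalIntegrable_eval (p : ℝ[X]) (a b : ℝ) :
    IntervalIntegrable (fun x => p.eval x) volume a b :=
  p.continuous.intervalIntegrable a b

theorem integral_eval_derivative (p : ℝ[X]) (a b : ℝ) :
    ∫ x in a..b, (derivative p).eval x = p.eval b - p.eval a :=
  intervalIntegral.integral_eq_sub_of_hasDerivAt (fun x _ => p.hasDerivAt x)
    (intervalIntegrable_eval _ _ _)

theorem intervalIntegrable_eval_mul_log (p : ℝ[X]) (a b : ℝ) :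
    IntervalIntegrable (fun x => p.eval x * Real.log x) volume a b :=
  intervalIntegral.intervalIntegrable_log'.continuousOn_mul p.continuous.continuousOn

/-- Integration by parts against the logarithm. -/
theorem integral_eval_derivative_X_mul_mul_log (p : ℝ[X]) :
    ∫ x in (0 : ℝ)..1, (derivative (X * p)).eval x * Real.log x =
      -∫ x in (0 : ℝ)..1, p.eval x := by
  have hcont : Continuous fun x : ℝ => p.eval x * (x * Real.log x) :=
    p.continuous.mul Real.continuous_mul_log
  have h := intervalIntegral.integral_eq_sub_of_hasDerivAt_of_le (a := 0) (b := 1)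
    (f := fun x : ℝ => p.eval x * (x * Real.log x))
    (f' := fun x => (derivative (X * p)).eval x * Real.log x + p.eval x) zero_le_one
    hcont.continuousOn
    (fun x hx => by
      have hx0 : x ≠ 0 := hx.1.ne'
      have hf : (fun x : ℝ => p.eval x * (x * Real.log x)) =
          (fun x => (X * p).eval x) * Real.log := by
        ext y
        simp only [Pi.mul_apply, eval_mul, eval_X]
        ring
      rw [hf]
      refine (((X * p).hasDerivAt x).mul (Real.hasDerivAt_log hx0)).congr_deriv ?_
      rw [eval_mul, eval_X, mul_comm x, mul_assoc, mul_inv_cancel₀ hx0, mul_one])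
    ((intervalIntegrable_eval_mul_log _ _ _).add (intervalIntegrable_eval _ _ _))
  rw [intervalIntegral.integral_add (intervalIntegrable_eval_mul_log _ _ _)
    (intervalIntegrable_eval _ _ _)] at h
  simp only [Real.log_one, mul_zero, zero_mul, sub_zero] at h
  linarith

end Polynomial

namespace shiftedLegendreP

open Polynomial

theorem integral_mul_X_pow_eq_zero {n k : ℕ} (h : k < n) :
    ∫ x in (0 : ℝ)..1, (shiftedLegendreP n * X ^ k).eval x = 0 := by
  induction k with
  | zero =>
    have hd := integral_eval_derivative (X * (1 - X) * derivative (shiftedLegendreP n)) 0 1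
    rw [derivative_mul_derivative] at hd
    simp only [eval_mul, eval_neg, eval_natCast, eval_add, eval_one, eval_X, eval_sub, sub_self,
      mul_zero, zero_mul, intervalIntegral.integral_const_mul] at hd
    have hn : (n : ℝ) ≠ 0 := by exact_mod_cast h.ne'
    have hn' : -((n : ℝ) * (n + 1)) ≠ 0 := neg_ne_zero.mpr (mul_ne_zero hn (by positivity))
    simpa using (mul_eq_zero.mp hd).resolve_left hn'
  | succ k ih =>
    specialize ih (by omega)
    have hd := integral_eval_derivative
      (X * (1 - X) * derivative (shiftedLegendreP n) * X ^ (k + 1) -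
        ((k : ℝ[X]) + 1) * (X ^ (k + 1) * (1 - X)) * shiftedLegendreP n) 0 1
    have he : derivative (X * (1 - X) * derivative (shiftedLegendreP n) * X ^ (k + 1) -
        ((k : ℝ[X]) + 1) * (X ^ (k + 1) * (1 - X)) * shiftedLegendreP n) =
        (((k : ℝ[X]) + 1) * ((k : ℝ[X]) + 2) - (n : ℝ[X]) * ((n : ℝ[X]) + 1)) * (shiftedLegendreP n * X ^ (k + 1)) -
          ((k : ℝ[X]) + 1) ^ 2 * (shiftedLegendreP n * X ^ k) := by
      rw [derivative_sub, derivative_mul, derivative_mul_derivative]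
      simp only [derivative_mul, derivative_sub, derivative_natCast,
        derivative_one, derivative_X, derivative_X_pow_succ, map_add, map_natCast, map_one]
      ring
    have hc : (((k : ℝ) + 1) * (k + 2) - n * (n + 1)) ≠ 0 := by
      have : (k : ℝ) + 1 < n := by exact_mod_cast h
      nlinarith [(Nat.cast_nonneg k : (0 : ℝ) ≤ k)]
    have hs : ∀ x : ℝ, ((((k : ℝ[X]) + 1) * ((k : ℝ[X]) + 2) - (n : ℝ[X]) * ((n : ℝ[X]) + 1)) *
          (shiftedLegendreP n * X ^ (k + 1)) -
          ((k : ℝ[X]) + 1) ^ 2 * (shiftedLegendreP n * X ^ k)).eval x =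
        (((k : ℝ) + 1) * (k + 2) - n * (n + 1)) * (shiftedLegendreP n * X ^ (k + 1)).eval x -
          ((k : ℝ) + 1) ^ 2 * (shiftedLegendreP n * X ^ k).eval x := by
      intro x; simp
    rw [he] at hd
    simp only [hs] at hd
    rw [intervalIntegral.integral_sub ((intervalIntegrable_eval _ _ _).const_mul _)
      ((intervalIntegrable_eval _ _ _).const_mul _), intervalIntegral.integral_const_mul,
      intervalIntegral.integral_const_mul, ih] at hd
    simp at hd
    simpa [hc] using hd

/-- `shiftedLegendreP n` is orthogonal to the polynomials of degree less than `n`. -/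
theorem integral_mul_eq_zero {n : ℕ} {q : ℝ[X]} (h : q.natDegree < n) :
    ∫ x in (0 : ℝ)..1, (shiftedLegendreP n * q).eval x = 0 := by
  have hs : ∀ x : ℝ, (shiftedLegendreP n * q).eval x =
      ∑ k ∈ Finset.range n, q.coeff k * (shiftedLegendreP n * X ^ k).eval x := by
    intro x
    rw [eval_mul, eval_eq_sum_range' h, Finset.mul_sum]
    refine Finset.sum_congr rfl fun k _ => ?_
    simp only [eval_mul, eval_pow, eval_X]
    ring
  simp only [hs]
  rw [intervalIntegral.integral_finsetSum
    fun k _ => (intervalIntegrable_eval _ _ _).const_mul _]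
  refine Finset.sum_eq_zero fun k hk => ?_
  rw [intervalIntegral.integral_const_mul, integral_mul_X_pow_eq_zero (Finset.mem_range.mp hk),
    mul_zero]

theorem integral_wronskian {n m : ℕ} (h : m < n) :
    ∫ x in (0 : ℝ)..1, ((1 - X) * (derivative (shiftedLegendreP n) * shiftedLegendreP m -
      shiftedLegendreP n * derivative (shiftedLegendreP m))).eval x = (-1) ^ (n + m + 1) := by
  set p := shiftedLegendreP n
  set q := shiftedLegendreP m with hq
  have hdeg : (q - 2 * ((1 - X) * derivative q)).natDegree < n := by
    refine lt_of_le_of_lt ((natDegree_sub_le _ _).trans (max_le (natDegree_le m) ?_)) h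
    rcases Nat.eq_zero_or_pos m with rfl | hm
    · simp [hq, shiftedLegendreP]
    · have h1 : (2 : ℝ[X]).natDegree ≤ 0 := by compute_degree
      have h2 : (1 - X : ℝ[X]).natDegree ≤ 1 := by compute_degree
      have h3 : (derivative q).natDegree ≤ m - 1 :=
        (natDegree_derivative_le q).trans (Nat.sub_le_sub_right (natDegree_le m) 1)
      exact (natDegree_mul_le_of_le h1 (natDegree_mul_le_of_le h2 h3)).trans (by omega)
  have he : (1 - X) * (derivative p * q - p * derivative q) =
      derivative ((1 - X) * (p * q)) + p * (q - 2 * ((1 - X) * derivative q)) := by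
    simp only [derivative_mul, derivative_sub, derivative_one, derivative_X]
    ring
  simp only [he, eval_add (p := derivative _)]
  rw [intervalIntegral.integral_add (intervalIntegrable_eval _ _ _)
    (intervalIntegrable_eval _ _ _), integral_eval_derivative, integral_mul_eq_zero hdeg]
  simp only [eval_mul, eval_sub, eval_one, eval_X, p, q, eval_zero]
  ring

end shiftedLegendreP

open Polynomial in
theorem stmt_0 (n m : ℕ) (h : n > m) :
    N n m = (-1 : ℝ) ^ (n + m + 1) / (((n : ℝ) - m) * ((n : ℝ) + m + 1)) := by
  have hlt : (m : ℝ) < n := by exact_mod_cast h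
  have hne : ((n : ℝ) - m) * ((n : ℝ) + m + 1) ≠ 0 :=
    mul_ne_zero (sub_pos.mpr hlt).ne' (by positivity)
  have hw := integral_eval_derivative_X_mul_mul_log
    ((1 - X) * (derivative (shiftedLegendreP n) * shiftedLegendreP m -
      shiftedLegendreP n * derivative (shiftedLegendreP m)))
  rw [shiftedLegendreP.integral_wronskian h] at hw
  have hd : derivative (X * ((1 - X) * (derivative (shiftedLegendreP n) * shiftedLegendreP m -
      shiftedLegendreP n * derivative (shiftedLegendreP m)))) =
      -(((n : ℝ[X]) - (m : ℝ[X])) * ((n : ℝ[X]) + (m : ℝ[X]) + 1)) * (shiftedLegendreP n * shiftedLegendreP m) := by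
    have hn := shiftedLegendreP.derivative_mul_derivative n
    have hm := shiftedLegendreP.derivative_mul_derivative m
    have he : X * ((1 - X) * (derivative (shiftedLegendreP n) * shiftedLegendreP m -
        shiftedLegendreP n * derivative (shiftedLegendreP m))) =
        X * (1 - X) * derivative (shiftedLegendreP n) * shiftedLegendreP m -
        X * (1 - X) * derivative (shiftedLegendreP m) * shiftedLegendreP n := by ring
    rw [he, derivative_sub, derivative_mul, derivative_mul (g := shiftedLegendreP n), hn, hm]
    ring
  rw [hd] at hw
  have hs : ∀ x : ℝ, (-(((n : ℝ[X]) - (m : ℝ[X])) * ((n : ℝ[X]) + (m : ℝ[X]) + 1)) *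
      (shiftedLegendreP n * shiftedLegendreP m)).eval x * Real.log x =
      -(((n : ℝ) - m) * (n + m + 1)) *
        (legendreP n (2 * x - 1) * legendreP m (2 * x - 1) * Real.log x) := by
    intro x
    simp only [eval_mul, eval_neg, eval_sub, eval_add, eval_natCast, eval_one,
      shiftedLegendreP.eval_eq_legendreP]
    ring
  simp only [hs, intervalIntegral.integral_const_mul] at hw
  rw [eq_div_iff hne, N]
  linarith
end

section
/- For every natural number n ≥ 1, the diagonal integrals N_{n,n} satisfy the recursion (2n+1)·N_{n,n} = (2n−1)·N_{n−1,n−1} − 2/((2n−1)·2n·(2n+1)). -/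
open MeasureTheory Real

/-- The derivative of `legendreP n`, given by differentiating the three-term recurrence. -/
noncomputable def legendreDeriv : ℕ → ℝ → ℝ
  | 0, _ => 0
  | 1, _ => 1
  | (n + 2), x =>
      ((2 * (n + 1 : ℝ) + 1) * (legendreP (n + 1) x + x * legendreDeriv (n + 1) x)
        - (n + 1 : ℝ) * legendreDeriv n x) / ((n + 1 : ℝ) + 1)

lemma legendreP_recurrence (n : ℕ) (x : ℝ) :
    ((n : ℝ) + 2) * legendreP (n + 2) x =
      (2 * (n : ℝ) + 3) * x * legendreP (n + 1) x - ((n : ℝ) + 1) * legendreP n x := by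
  have h : (n : ℝ) + 1 + 1 ≠ 0 := by positivity
  rw [legendreP]
  field_simp
  ring

lemma legendreDeriv_recurrence (n : ℕ) (x : ℝ) :
    ((n : ℝ) + 2) * legendreDeriv (n + 2) x =
      (2 * (n : ℝ) + 3) * (legendreP (n + 1) x + x * legendreDeriv (n + 1) x)
        - ((n : ℝ) + 1) * legendreDeriv n x := by
  have h : (n : ℝ) + 1 + 1 ≠ 0 := by positivity
  rw [legendreDeriv]
  field_simp
  ring

lemma hasDerivAt_legendreP (n : ℕ) (x : ℝ) :
    HasDerivAt (legendreP n) (legendreDeriv n x) x := by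
  induction n using Nat.twoStepInduction with
  | zero => exact (hasDerivAt_const x (1 : ℝ))
  | one => exact hasDerivAt_id x
  | more n h0 h1 =>
    have h := ((((hasDerivAt_id x).const_mul (2 * (n + 1 : ℝ) + 1)).mul h1).sub
      (h0.const_mul (n + 1 : ℝ))).div_const ((n + 1 : ℝ) + 1)
    refine h.congr_deriv ?_
    simp only [legendreDeriv, id]
    ring

lemma continuous_legendreP (n : ℕ) : Continuous (legendreP n) :=
  continuous_iff_continuousAt.2 fun x => (hasDerivAt_legendreP n x).continuousAt

lemma continuous_legendreDeriv (n : ℕ) : Continuous (legendreDeriv n) := by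
  induction n using Nat.twoStepInduction with
  | zero => exact continuous_const
  | one => exact continuous_const
  | more n h0 h1 =>
    have := continuous_legendreP (n + 1)
    change Continuous fun x => ((2 * (n + 1 : ℝ) + 1) *
      (legendreP (n + 1) x + x * legendreDeriv (n + 1) x)
        - (n + 1 : ℝ) * legendreDeriv n x) / ((n + 1 : ℝ) + 1)
    fun_prop

lemma legendreP_one_right (n : ℕ) : legendreP n 1 = 1 := by
  induction n using Nat.twoStepInduction with
  | zero => rfl
  | one => rfl
  | more n h0 h1 =>
    have h : (n : ℝ) + 2 ≠ 0 := by positivity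
    have := legendreP_recurrence n 1
    rw [h0, h1] at this
    apply mul_left_cancel₀ h
    linarith

lemma legendreP_neg_one_right (n : ℕ) : legendreP n (-1) = (-1) ^ n := by
  induction n using Nat.twoStepInduction with
  | zero => simp [legendreP]
  | one => simp [legendreP]
  | more n h0 h1 =>
    have h : (n : ℝ) + 2 ≠ 0 := by positivity
    have := legendreP_recurrence n (-1)
    rw [h0, h1] at this
    apply mul_left_cancel₀ h
    rw [this]
    ring

lemma legendreDeriv_succ_and (n : ℕ) (x : ℝ) :
    legendreDeriv (n + 1) x = x * legendreDeriv n x + ((n : ℝ) + 1) * legendreP n x ∧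
    x * legendreDeriv (n + 1) x - legendreDeriv n x = ((n : ℝ) + 1) * legendreP (n + 1) x := by
  induction n with
  | zero => simp [legendreDeriv, legendreP]
  | succ n ih =>
    obtain ⟨ha, hb⟩ := ih
    have h : (n : ℝ) + 2 ≠ 0 := by positivity
    have hD := legendreDeriv_recurrence n x
    have hP := legendreP_recurrence n x
    have hA : legendreDeriv (n + 2) x =
        x * legendreDeriv (n + 1) x + ((n : ℝ) + 2) * legendreP (n + 1) x := by
      apply mul_left_cancel₀ h
      rw [hD]
      linear_combination ((n : ℝ) + 1) * hb
    push_cast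
    refine ⟨by linear_combination hA, ?_⟩
    linear_combination x * hA - ha + x * hb - hP

lemma legendreDeriv_succ (n : ℕ) (x : ℝ) :
    legendreDeriv (n + 1) x = x * legendreDeriv n x + ((n : ℝ) + 1) * legendreP n x :=
  (legendreDeriv_succ_and n x).1

lemma mul_legendreDeriv_succ_sub (n : ℕ) (x : ℝ) :
    x * legendreDeriv (n + 1) x - legendreDeriv n x = ((n : ℝ) + 1) * legendreP (n + 1) x :=
  (legendreDeriv_succ_and n x).2

lemma legendreDeriv_add_two (n : ℕ) (x : ℝ) :
    legendreDeriv (n + 2) x = legendreDeriv n x + (2 * (n : ℝ) + 3) * legendreP (n + 1) x := by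
  have h1 := legendreDeriv_succ (n + 1) x
  have h2 := mul_legendreDeriv_succ_sub n x
  push_cast at h1
  linear_combination h1 + h2

/-- Legendre's differential equation. -/
lemma hasDerivAt_one_sub_sq_mul_legendreDeriv (n : ℕ) (x : ℝ) :
    HasDerivAt (fun t => (1 - t ^ 2) * legendreDeriv n t)
      (-((n : ℝ) * (n + 1)) * legendreP n x) x := by
  cases n with
  | zero => simpa [legendreDeriv] using hasDerivAt_const x (0 : ℝ)
  | succ n =>
    have hf : (fun t => (1 - t ^ 2) * legendreDeriv (n + 1) t) =
        fun t => ((n : ℝ) + 1) * (legendreP n t - t * legendreP (n + 1) t) := by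
      funext t
      linear_combination legendreDeriv_succ n t - t * mul_legendreDeriv_succ_sub n t
    rw [hf]
    refine (((hasDerivAt_legendreP n x).sub
      ((hasDerivAt_id x).mul (hasDerivAt_legendreP (n + 1) x))).const_mul
        ((n : ℝ) + 1)).congr_deriv ?_
    simp only [id]
    push_cast
    linear_combination (-(n : ℝ) - 1) * mul_legendreDeriv_succ_sub n x

lemma integral_legendreP_mul_legendreP {m n : ℕ} (h : m < n) :
    ∫ x in (-1 : ℝ)..1, legendreP n x * legendreP m x = 0 := by
  have hd : ∀ x ∈ Set.uIcc (-1 : ℝ) 1, HasDerivAt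
      (fun t => legendreP n t * ((1 - t ^ 2) * legendreDeriv m t)
        - legendreP m t * ((1 - t ^ 2) * legendreDeriv n t))
      (((n : ℝ) * (n + 1) - (m : ℝ) * (m + 1)) * (legendreP n x * legendreP m x)) x := by
    intro x _
    refine (((hasDerivAt_legendreP n x).mul (hasDerivAt_one_sub_sq_mul_legendreDeriv m x)).sub
      ((hasDerivAt_legendreP m x).mul
        (hasDerivAt_one_sub_sq_mul_legendreDeriv n x))).congr_deriv ?_
    ring
  have hc : Continuous fun x =>
      ((n : ℝ) * (n + 1) - (m : ℝ) * (m + 1)) * (legendreP n x * legendreP m x) := by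
    have := continuous_legendreP n
    have := continuous_legendreP m
    fun_prop
  have hI := intervalIntegral.integral_eq_sub_of_hasDerivAt hd (hc.intervalIntegrable _ _)
  rw [intervalIntegral.integral_const_mul] at hI
  have hmn : (m : ℝ) < n := by exact_mod_cast h
  have hm : (0 : ℝ) ≤ m := by positivity
  have hne : (n : ℝ) * (n + 1) - (m : ℝ) * (m + 1) ≠ 0 := by nlinarith
  apply mul_left_cancel₀ hne
  rw [hI]
  norm_num

lemma integral_legendreP_mul_legendreDeriv {m n : ℕ} (h : m < n) :
    ∫ x in (-1 : ℝ)..1, legendreP n x * legendreDeriv m x = 0 := by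
  induction m using Nat.twoStepInduction with
  | zero => simp [legendreDeriv]
  | one =>
    simpa [legendreDeriv, legendreP] using
      integral_legendreP_mul_legendreP (m := 0) (n := n) (by omega)
  | more m h0 _ =>
    have hP := continuous_legendreP n
    have hQ := continuous_legendreP (m + 1)
    have hD := continuous_legendreDeriv m
    have hf : (fun x => legendreP n x * legendreDeriv (m + 2) x) = fun x =>
        legendreP n x * legendreDeriv m x
          + (2 * (m : ℝ) + 3) * (legendreP n x * legendreP (m + 1) x) := by
      funext x
      rw [legendreDeriv_add_two]
      ring
    rw [hf, intervalIntegral.integral_add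
      (Continuous.intervalIntegrable (by fun_prop) _ _)
      (Continuous.intervalIntegrable (by fun_prop) _ _),
      intervalIntegral.integral_const_mul, h0 (by omega),
      integral_legendreP_mul_legendreP (by omega)]
    ring

lemma hasDerivAt_legendreP_sq_combination (n : ℕ) (x : ℝ) :
    HasDerivAt (fun t => t * (legendreP (n + 1) t ^ 2 + legendreP n t ^ 2)
        - 2 * (legendreP (n + 1) t * legendreP n t))
      ((2 * (n : ℝ) + 3) * legendreP (n + 1) x ^ 2 - (2 * (n : ℝ) + 1) * legendreP n x ^ 2) x := by
  have hp := hasDerivAt_legendreP (n + 1) x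
  have hq := hasDerivAt_legendreP n x
  refine (((hasDerivAt_id x).mul ((hp.pow 2).add (hq.pow 2))).sub
    ((hp.mul hq).const_mul 2)).congr_deriv ?_
  simp only [id, Pi.add_apply, Pi.pow_apply]
  push_cast
  linear_combination 2 * legendreP (n + 1) x * mul_legendreDeriv_succ_sub n x
    - 2 * legendreP n x * legendreDeriv_succ n x

lemma integral_legendreP_sq (n : ℕ) :
    (2 * (n : ℝ) + 1) * ∫ x in (-1 : ℝ)..1, legendreP n x ^ 2 = 2 := by
  induction n with
  | zero => norm_num [legendreP]
  | succ n ih =>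
    have hp := continuous_legendreP (n + 1)
    have hq := continuous_legendreP n
    have hI := intervalIntegral.integral_eq_sub_of_hasDerivAt (a := -1) (b := 1)
      (fun x _ => hasDerivAt_legendreP_sq_combination n x)
      (Continuous.intervalIntegrable (by fun_prop) _ _)
    rw [intervalIntegral.integral_sub
      (Continuous.intervalIntegrable (by fun_prop) _ _)
      (Continuous.intervalIntegrable (by fun_prop) _ _),
      intervalIntegral.integral_const_mul, intervalIntegral.integral_const_mul, ih] at hI
    simp only [legendreP_one_right, legendreP_neg_one_right] at hI
    push_cast
    linear_combination hI

/-- The quotient of `t * (Pₙ₊₁² + Pₙ²) - 2 * Pₙ₊₁ * Pₙ` by `1 + t`. -/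
noncomputable def legendreQuotient (n : ℕ) (t : ℝ) : ℝ :=
  legendreP (n + 1) t ^ 2 + legendreP n t ^ 2
    - (legendreP (n + 1) t + legendreP n t) * (legendreDeriv (n + 1) t - legendreDeriv n t)
      / ((n : ℝ) + 1)

lemma continuous_legendreQuotient (n : ℕ) : Continuous (legendreQuotient n) := by
  have := continuous_legendreP (n + 1)
  have := continuous_legendreP n
  have := continuous_legendreDeriv (n + 1)
  have := continuous_legendreDeriv n
  unfold legendreQuotient
  fun_prop

lemma one_add_mul_legendreQuotient (n : ℕ) (t : ℝ) :
    (1 + t) * legendreQuotient n t = t * (legendreP (n + 1) t ^ 2 + legendreP n t ^ 2)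
        - 2 * (legendreP (n + 1) t * legendreP n t) := by
  have h : (n : ℝ) + 1 ≠ 0 := by positivity
  unfold legendreQuotient
  field_simp
  linear_combination -(legendreP (n + 1) t + legendreP n t) *
    (legendreDeriv_succ n t + mul_legendreDeriv_succ_sub n t)

lemma integral_legendreQuotient (n : ℕ) :
    ∫ t in (-1 : ℝ)..1, legendreQuotient n t =
      2 / (2 * (n : ℝ) + 3) + 2 / (2 * (n : ℝ) + 1) - 2 / ((n : ℝ) + 1) := by
  have hp := continuous_legendreP (n + 1)
  have hq := continuous_legendreP n
  have hp' := continuous_legendreDeriv (n + 1)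
  have hq' := continuous_legendreDeriv n
  have hn : (n : ℝ) + 1 ≠ 0 := by positivity
  have hd : ∀ x ∈ Set.uIcc (-1 : ℝ) 1, HasDerivAt
      (fun t => (legendreP (n + 1) t ^ 2 - legendreP n t ^ 2) / 2
        + legendreP (n + 1) t * legendreP n t)
      ((legendreP (n + 1) x + legendreP n x) * (legendreDeriv (n + 1) x - legendreDeriv n x)
        + 2 * (legendreP (n + 1) x * legendreDeriv n x)) x := by
    intro x _
    have hp := hasDerivAt_legendreP (n + 1) x
    have hq := hasDerivAt_legendreP n x
    refine ((((hp.pow 2).sub (hq.pow 2)).div_const 2).add (hp.mul hq)).congr_deriv ?_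
    push_cast
    ring
  have hI := intervalIntegral.integral_eq_sub_of_hasDerivAt hd
    (Continuous.intervalIntegrable (by fun_prop) _ _)
  rw [intervalIntegral.integral_add
      (Continuous.intervalIntegrable (by fun_prop) _ _)
      (Continuous.intervalIntegrable (by fun_prop) _ _),
    intervalIntegral.integral_const_mul,
    integral_legendreP_mul_legendreDeriv (Nat.lt_succ_self n)] at hI
  have h1 : ((-1 : ℝ) ^ n) ^ 2 = 1 := by rw [← pow_mul, mul_comm, pow_mul]; norm_num
  simp only [legendreP_one_right, legendreP_neg_one_right, pow_succ (-1 : ℝ) n] at hI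
  have hJ : ∫ x in (-1 : ℝ)..1, (legendreP (n + 1) x + legendreP n x) *
      (legendreDeriv (n + 1) x - legendreDeriv n x) = 2 := by
    linear_combination hI + h1
  have hA := integral_legendreP_sq (n + 1)
  have hB := integral_legendreP_sq n
  unfold legendreQuotient
  rw [intervalIntegral.integral_sub
      (Continuous.intervalIntegrable (by fun_prop) _ _)
      (Continuous.intervalIntegrable (by fun_prop) _ _),
    intervalIntegral.integral_add
      (Continuous.intervalIntegrable (by fun_prop) _ _)
      (Continuous.intervalIntegrable (by fun_prop) _ _),
    intervalIntegral.integral_div, hJ]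
  push_cast at hA
  congr 1
  congr 1
  · rw [eq_div_iff (by positivity)]
    linear_combination hA
  · rw [eq_div_iff (by positivity)]
    linear_combination hB

/-- Integration by parts against the logarithm: the boundary terms of `x * K x * log x` vanish. -/
lemma integral_mul_log_of_hasDerivAt {K g : ℝ → ℝ} (hK : Continuous K) (hg : Continuous g)
    (hd : ∀ x, HasDerivAt (fun y => y * K y) (g x) x) :
    ∫ x in (0 : ℝ)..1, g x * log x = -∫ x in (0 : ℝ)..1, K x := by
  have hgi : IntervalIntegrable (fun x => g x * log x) volume 0 1 :=
    intervalIntegral.intervalIntegrable_log'.continuousOn_mul hg.continuousOn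
  have hKi : IntervalIntegrable K volume 0 1 := hK.intervalIntegrable _ _
  have hI := intervalIntegral.integral_eq_sub_of_hasDerivAt_of_le (a := 0) (b := 1)
    (f := fun x => K x * (x * log x)) (f' := fun x => g x * log x + K x) zero_le_one
    (hK.mul continuous_mul_log).continuousOn
    (fun x hx => by
      have hx0 : x ≠ 0 := hx.1.ne'
      have h := (hd x).mul (hasDerivAt_log hx0)
      have hf : (fun y => K y * (y * log y)) = (fun y => y * K y) * log := by
        funext y
        simp only [Pi.mul_apply]
        ring
      rw [hf]
      refine h.congr_deriv ?_
      field_simp)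
    (hgi.add hKi)
  rw [intervalIntegral.integral_add hgi hKi] at hI
  simp only [log_one, mul_zero, zero_mul, sub_zero] at hI
  linarith

theorem stmt_2 (n : ℕ) (h : 1 ≤ n) :
    (2 * (n : ℝ) + 1) * N n n =
      (2 * (n : ℝ) - 1) * N (n - 1) (n - 1)
        - 2 / ((2 * (n : ℝ) - 1) * (2 * (n : ℝ)) * (2 * (n : ℝ) + 1)) := by
  obtain ⟨n, rfl⟩ : ∃ k, n = k + 1 := ⟨n - 1, by omega⟩
  have hp := continuous_legendreP (n + 1)
  have hq := continuous_legendreP n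
  have hK := continuous_legendreQuotient n
  have hd : ∀ x : ℝ, HasDerivAt (fun y => y * legendreQuotient n (2 * y - 1))
      ((2 * (n : ℝ) + 3) * legendreP (n + 1) (2 * x - 1) ^ 2
        - (2 * (n : ℝ) + 1) * legendreP n (2 * x - 1) ^ 2) x := by
    intro x
    have hl : HasDerivAt (fun y : ℝ => 2 * y - 1) 2 x := by
      simpa using ((hasDerivAt_id x).const_mul 2).sub_const 1
    have hc := ((hasDerivAt_legendreP_sq_combination n (2 * x - 1)).comp x hl).div_const 2
    have hf : (fun y => y * legendreQuotient n (2 * y - 1)) = fun y =>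
        ((fun t => t * (legendreP (n + 1) t ^ 2 + legendreP n t ^ 2)
          - 2 * (legendreP (n + 1) t * legendreP n t)) ∘ fun y : ℝ => 2 * y - 1) y / 2 := by
      funext y
      simp only [Function.comp_apply]
      rw [← one_add_mul_legendreQuotient]
      ring
    rw [hf]
    exact hc.congr_deriv (by ring)
  have hI := integral_mul_log_of_hasDerivAt (K := fun y => legendreQuotient n (2 * y - 1))
    (by fun_prop) (by fun_prop) hd
  have hs : ∫ x in (0 : ℝ)..1, legendreQuotient n (2 * x - 1) =
      (∫ t in (-1 : ℝ)..1, legendreQuotient n t) / 2 := by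
    rw [intervalIntegral.integral_comp_mul_sub (legendreQuotient n) two_ne_zero 1]
    norm_num
    ring
  have hi : ∀ m : ℕ, IntervalIntegrable
      (fun x => legendreP m (2 * x - 1) * legendreP m (2 * x - 1) * log x) volume 0 1 := by
    intro m
    have hm := continuous_legendreP m
    exact intervalIntegral.intervalIntegrable_log'.continuousOn_mul
      (Continuous.continuousOn (by fun_prop))
  have hN : (2 * (n : ℝ) + 3) * N (n + 1) (n + 1) - (2 * (n : ℝ) + 1) * N n n =
      ∫ x in (0 : ℝ)..1, ((2 * (n : ℝ) + 3) * legendreP (n + 1) (2 * x - 1) ^ 2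
        - (2 * (n : ℝ) + 1) * legendreP n (2 * x - 1) ^ 2) * log x := by
    unfold N
    rw [← intervalIntegral.integral_const_mul, ← intervalIntegral.integral_const_mul,
      ← intervalIntegral.integral_sub ((hi (n + 1)).const_mul _) ((hi n).const_mul _)]
    congr 1
    funext x
    ring
  rw [hI, hs, integral_legendreQuotient] at hN
  have e1 : (2 * ((n + 1 : ℕ) : ℝ) + 1) = 2 * (n : ℝ) + 3 := by push_cast; ring
  have e2 : (2 * ((n + 1 : ℕ) : ℝ) - 1) = 2 * (n : ℝ) + 1 := by push_cast; ring
  have e3 : (2 * ((n + 1 : ℕ) : ℝ)) = 2 * ((n : ℝ) + 1) := by push_cast; ring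
  rw [e1, e2, e3, Nat.add_sub_cancel]
  have hr : (2 / (2 * (n : ℝ) + 3) + 2 / (2 * (n : ℝ) + 1) - 2 / ((n : ℝ) + 1)) / 2 =
      2 / ((2 * (n : ℝ) + 1) * (2 * ((n : ℝ) + 1)) * (2 * (n : ℝ) + 3)) := by
    field_simp
    ring
  rw [hr] at hN
  linear_combination hN
end
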